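/- Assume the nondegeneracy condition h₀₁² + h₀₂² + h₁₂² ≠ 0 at λ̄ and that r² > h₁₂². Let λ be the extremal passing through λ̄ (i.e. λ(t̄) = λ̄ for some time t̄, and λ(t) ∉ Λ for t ≠ t̄ near t̄), with control u. Then u has a jump discontinuity at t̄ with one-sided limits u(t̄ ± 0) = (1/r²) · ( −h₀₂ h₁₂ ± h₀₁ (r² − h₁₂²)^{1/2}, h₀₁ h₁₂ ± h₀₂ (r² − h₁₂²)^{1/2} ). -/

import Mathlib

noncomputable section

open MeasureTheory Real Set

/-- The state space: ℝ³, realized as `Fin 3 → ℝ`. -/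
abbrev E3 : Type := Fin 3 → ℝ

/-- Euclidean inner product on ℝ³. -/
def dot3 (a b : E3) : ℝ := ∑ i, a i * b i

/-- Lie bracket of two vector fields: `[f, g](x) = Dg(x) f(x) − Df(x) g(x)`. -/
def lie (f g : E3 → E3) : E3 → E3 :=
  fun x => fderiv ℝ g x (f x) - fderiv ℝ f x (g x)

/-- The control set: the closed unit disk in ℝ². -/
def U2 : Set (ℝ × ℝ) := {u | u.1 ^ 2 + u.2 ^ 2 ≤ 1}

/-- An admissible control on the time set `I`: measurable with values in the unit disk.
(Essential boundedness is automatic since `U2` is bounded.) -/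
def AdmControl (u : ℝ → ℝ × ℝ) (I : Set ℝ) : Prop :=
  Measurable u ∧ ∀ t ∈ I, u t ∈ U2

/-- An admissible trajectory of `q̇ = f₀(q) + u₁ f₁(q) + u₂ f₂(q)` on `I`,
with control `u`: locally Lipschitz (here: Lipschitz on `I`) and satisfying
the ODE almost everywhere on `I`. -/
def IsTraj (f0 f1 f2 : E3 → E3) (u : ℝ → ℝ × ℝ) (q : ℝ → E3) (I : Set ℝ) : Prop :=
  (∃ K, LipschitzOnWith K q I) ∧
  ∀ᵐ t, t ∈ I → HasDerivAt q
    (f0 (q t) + (u t).1 • f1 (q t) + (u t).2 • f2 (q t)) t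

/-- `q : [0, t₁] → ℝ³` is a time-optimal trajectory: it is an admissible trajectory,
and no admissible trajectory joins `q 0` to `q t₁` in time strictly less than `t₁`. -/
def TimeOpt (f0 f1 f2 : E3 → E3) (q : ℝ → E3) (t1 : ℝ) : Prop :=
  0 ≤ t1 ∧
  (∃ u, AdmControl u (Icc 0 t1) ∧ IsTraj f0 f1 f2 u q (Icc 0 t1)) ∧
  ¬ ∃ s, 0 ≤ s ∧ s < t1 ∧ ∃ u p, AdmControl u (Icc 0 s) ∧
      IsTraj f0 f1 f2 u p (Icc 0 s) ∧ p 0 = q 0 ∧ p s = q t1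

/-- For `λ = (ξ, x)`, the Hamiltonian lift `h_f(λ) = ⟨ξ, f(x)⟩` of a vector field `f`. -/
def hF (f : E3 → E3) (l : E3 × E3) : ℝ := dot3 l.1 (f l.2)

/-- The (pre-maximized) Hamiltonian `h₀ + v₁ h₁ + v₂ h₂` at `λ`, for a control value `v`. -/
def Ham (f0 f1 f2 : E3 → E3) (v : ℝ × ℝ) (l : E3 × E3) : ℝ :=
  hF f0 l + v.1 * hF f1 l + v.2 * hF f2 l

/-- A Pontryagin extremal `λ(t) = (ξ(t), x(t))` with control `u` on the time set `I`:
locally Lipschitz, `ξ(t) ≠ 0`, satisfying a.e. the Hamiltonian system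
`x' = f₀(x) + u₁ f₁(x) + u₂ f₂(x)`,
`ξ' = −(Df₀(x) + u₁ Df₁(x) + u₂ Df₂(x))ᵀ ξ` (expressed via the inner product),
the maximality condition, and nonnegativity of the maximized Hamiltonian. -/
def IsExtremal (f0 f1 f2 : E3 → E3) (u : ℝ → ℝ × ℝ) (lam : ℝ → E3 × E3)
    (I : Set ℝ) : Prop :=
  (∃ K, LipschitzOnWith K lam I) ∧
  AdmControl u I ∧
  (∀ t ∈ I, (lam t).1 ≠ 0) ∧
  ∀ᵐ t, t ∈ I →
    (HasDerivAt (fun s => (lam s).2)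
      (f0 ((lam t).2) + (u t).1 • f1 ((lam t).2) + (u t).2 • f2 ((lam t).2)) t) ∧
    (∃ w : E3, HasDerivAt (fun s => (lam s).1) w t ∧
      ∀ v : E3, dot3 w v =
        - dot3 ((lam t).1)
          (fderiv ℝ f0 ((lam t).2) v + (u t).1 • fderiv ℝ f1 ((lam t).2) v
            + (u t).2 • fderiv ℝ f2 ((lam t).2) v)) ∧
    (∀ v ∈ U2, Ham f0 f1 f2 v (lam t) ≤ Ham f0 f1 f2 (u t) (lam t)) ∧
    0 ≤ Ham f0 f1 f2 (u t) (lam t)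

/-- The singular locus `Λ = {(ξ, x) : ⟨ξ, f₁(x)⟩ = ⟨ξ, f₂(x)⟩ = 0}`. -/
def SingLocus (f1 f2 : E3 → E3) : Set (E3 × E3) :=
  {l | hF f1 l = 0 ∧ hF f2 l = 0}

/-- A Lipschitz function whose derivative is almost everywhere at least `m` grows at rate at
least `m`. -/
theorem LipschitzOnWith.mul_sub_le_sub_of_ae_hasDerivAt {f : ℝ → ℝ} {K : NNReal} {a b m : ℝ}
    (hf : LipschitzOnWith K f (Ioo a b))
    (hd : ∀ᵐ t, t ∈ Ioo a b → ∃ d, HasDerivAt f d t ∧ m ≤ d)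
    {x y : ℝ} (hx : x ∈ Ioo a b) (hy : y ∈ Ioo a b) (hxy : x ≤ y) :
    m * (y - x) ≤ f y - f x := by
  have hsub : Icc x y ⊆ Ioo a b := Icc_subset_Ioo hx.1 hy.2
  have hac : AbsolutelyContinuousOnInterval f x y := by
    apply LipschitzOnWith.absolutelyContinuousOnInterval (K := K)
    rw [uIcc_of_le hxy]
    exact hf.mono hsub
  rw [← hac.integral_deriv_eq_sub]
  have hc : ∫ _ in x..y, m = m * (y - x) := by simp [mul_comm]
  rw [← hc]
  refine intervalIntegral.integral_mono_ae_restrict hxy (by simp) hac.intervalIntegrable_deriv ?_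
  rw [Filter.EventuallyLE, ae_restrict_iff' measurableSet_Icc]
  filter_upwards [hd] with t ht hmem
  obtain ⟨d, h1, h2⟩ := ht (hsub hmem)
  rwa [h1.deriv]

theorem abs_sqrt_sq_add_sq_sub_le (a b c d : ℝ) :
    |√(a ^ 2 + b ^ 2) - √(c ^ 2 + d ^ 2)| ≤ |a - c| + |b - d| := by
  have key := abs_norm_sub_norm_le (⟨a, b⟩ : ℂ) ⟨c, d⟩
  have h := Complex.norm_le_abs_re_add_abs_im ((⟨a, b⟩ : ℂ) - ⟨c, d⟩)
  simp only [Complex.norm_eq_sqrt_sq_add_sq, Complex.sub_re, Complex.sub_im] at key h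
  exact key.trans h

/-- The direction of a planar curve `z` issuing from the origin, when
`z' = (H₁, H₂) + H₁₂ J z / |z|` with `J` the quarter turn. -/
theorem tendsto_direction_of_planar_system {z1 z2 H1 H2 H12 : ℝ → ℝ} {K : NNReal}
    {a b tb h1 h2 h12 r : ℝ} (htb : tb ∈ Ioo a b)
    (hz1 : LipschitzOnWith K z1 (Ioo a b)) (hz2 : LipschitzOnWith K z2 (Ioo a b))
    (hz1tb : z1 tb = 0) (hz2tb : z2 tb = 0)
    (hne : ∀ t ∈ Ioo a b, t ≠ tb → 0 < z1 t ^ 2 + z2 t ^ 2)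
    (hH1 : Filter.Tendsto H1 (nhds tb) (nhds h1))
    (hH2 : Filter.Tendsto H2 (nhds tb) (nhds h2))
    (hH12 : Filter.Tendsto H12 (nhds tb) (nhds h12))
    (hr : 0 < r) (hr2 : r ^ 2 = h1 ^ 2 + h2 ^ 2) (hgt : h12 ^ 2 < r ^ 2)
    (hd : ∀ᵐ t, t ∈ Ioo a b →
      HasDerivAt z1 (H1 t - z2 t / √(z1 t ^ 2 + z2 t ^ 2) * H12 t) t ∧
      HasDerivAt z2 (H2 t + z1 t / √(z1 t ^ 2 + z2 t ^ 2) * H12 t) t) :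
    Filter.Tendsto (fun t => (z1 t / √(z1 t ^ 2 + z2 t ^ 2), z2 t / √(z1 t ^ 2 + z2 t ^ 2)))
      (nhdsWithin tb (Iio tb))
      (nhds ((1 / r ^ 2) * (-h2 * h12 - h1 * √(r ^ 2 - h12 ^ 2)),
             (1 / r ^ 2) * (h1 * h12 - h2 * √(r ^ 2 - h12 ^ 2)))) ∧
    Filter.Tendsto (fun t => (z1 t / √(z1 t ^ 2 + z2 t ^ 2), z2 t / √(z1 t ^ 2 + z2 t ^ 2)))
      (nhdsWithin tb (Ioi tb))
      (nhds ((1 / r ^ 2) * (-h2 * h12 + h1 * √(r ^ 2 - h12 ^ 2)),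
             (1 / r ^ 2) * (h1 * h12 + h2 * √(r ^ 2 - h12 ^ 2)))) := by
  set ρ : ℝ → ℝ := fun t => √(z1 t ^ 2 + z2 t ^ 2) with hρ
  have hρpos : ∀ t ∈ Ioo a b, t ≠ tb → 0 < ρ t := fun t ht htne =>
    Real.sqrt_pos.2 (hne t ht htne)
  have hρsq : ∀ t, ρ t ^ 2 = z1 t ^ 2 + z2 t ^ 2 := fun t => Real.sq_sqrt (by positivity)
  have hρtb : ρ tb = 0 := by simp [hρ, hz1tb, hz2tb]
  have hunit : ∀ t ∈ Ioo a b, t ≠ tb → (z1 t / ρ t) ^ 2 + (z2 t / ρ t) ^ 2 = 1 := by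
    intro t ht htne
    have := (hρpos t ht htne).ne'
    rw [div_pow, div_pow, ← add_div, ← hρsq]
    field_simp
  have hae : ∀ᵐ t : ℝ, t ≠ tb := by simp [ae_iff, measure_singleton]
  let p : ℝ → ℝ := fun t => h1 * z1 t + h2 * z2 t
  let g : ℝ → ℝ := fun t => h1 * z2 t - h2 * z1 t - h12 * ρ t
  have hpL : LipschitzOnWith ((‖h1‖₊ + ‖h2‖₊) * K) p (Ioo a b) := by
    refine LipschitzOnWith.of_dist_le_mul fun x hx y hy => ?_
    have e1 := hz1.dist_le_mul x hx y hy
    have e2 := hz2.dist_le_mul x hx y hy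
    simp only [Real.dist_eq] at e1 e2 ⊢
    have : p x - p y = h1 * (z1 x - z1 y) + h2 * (z2 x - z2 y) := by simp only [p]; ring
    rw [this]
    refine (abs_add_le _ _).trans ?_
    rw [abs_mul, abs_mul]
    push_cast
    simp only [Real.norm_eq_abs]
    nlinarith [mul_le_mul_of_nonneg_left e1 (abs_nonneg h1),
      mul_le_mul_of_nonneg_left e2 (abs_nonneg h2)]
  have hgL : LipschitzOnWith ((‖h1‖₊ + ‖h2‖₊ + 2 * ‖h12‖₊) * K) g (Ioo a b) := by
    refine LipschitzOnWith.of_dist_le_mul fun x hx y hy => ?_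
    have e1 := hz1.dist_le_mul x hx y hy
    have e2 := hz2.dist_le_mul x hx y hy
    simp only [Real.dist_eq] at e1 e2 ⊢
    have e3 : |ρ x - ρ y| ≤ 2 * (K * |x - y|) := by
      have := abs_sqrt_sq_add_sq_sub_le (z1 x) (z2 x) (z1 y) (z2 y)
      simp only [hρ]
      linarith
    have : g x - g y = h1 * (z2 x - z2 y) + (-h2 * (z1 x - z1 y) + -h12 * (ρ x - ρ y)) := by
      simp only [g]; ring
    rw [this]
    refine (abs_add_le _ _).trans ((add_le_add_right (abs_add_le _ _) _).trans ?_)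
    rw [abs_mul, abs_mul, abs_mul, abs_neg, abs_neg]
    push_cast
    simp only [Real.norm_eq_abs]
    nlinarith [mul_le_mul_of_nonneg_left e1 (abs_nonneg h2),
      mul_le_mul_of_nonneg_left e2 (abs_nonneg h1),
      mul_le_mul_of_nonneg_left e3 (abs_nonneg h12)]
  have hpd : ∀ᵐ t, t ∈ Ioo a b → t ≠ tb ∧ HasDerivAt p
      (h1 * H1 t + h2 * H2 t + H12 t * (h2 * (z1 t / ρ t) - h1 * (z2 t / ρ t))) t := by
    filter_upwards [hd, hae] with t ht htne hmem
    obtain ⟨d1, d2⟩ := ht hmem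
    refine ⟨htne, ((d1.const_mul h1).add (d2.const_mul h2)).congr_deriv ?_⟩
    simp only [hρ]; ring
  have hgd : ∀ᵐ t, t ∈ Ioo a b → t ≠ tb ∧ HasDerivAt g
      ((h1 * H2 t - h2 * H1 t) + (H12 t * h1 - h12 * H1 t) * (z1 t / ρ t)
        + (H12 t * h2 - h12 * H2 t) * (z2 t / ρ t)) t := by
    filter_upwards [hd, hae] with t ht htne hmem
    obtain ⟨d1, d2⟩ := ht hmem
    have hp := hρpos t hmem htne
    refine ⟨htne, (((d2.const_mul h1).sub (d1.const_mul h2)).sub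
      ((((d1.pow 2).add (d2.pow 2)).sqrt (hne t hmem htne).ne').const_mul h12)).congr_deriv ?_⟩
    change h1 * (H2 t + z1 t / ρ t * H12 t) - h2 * (H1 t - z2 t / ρ t * H12 t)
      - h12 * ((_ * z1 t ^ _ * (H1 t - z2 t / ρ t * H12 t)
        + _ * z2 t ^ _ * (H2 t + z1 t / ρ t * H12 t)) / (2 * ρ t)) = _
    field_simp
    norm_num
    ring
  have hcoef : ∀ t ∈ Ioo a b, t ≠ tb → |z1 t / ρ t| ≤ 1 ∧ |z2 t / ρ t| ≤ 1 ∧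
      |h2 * (z1 t / ρ t) - h1 * (z2 t / ρ t)| ≤ r := by
    intro t ht htne
    have hu := hunit t ht htne
    refine ⟨(sq_le_one_iff_abs_le_one _).1 (by linarith [sq_nonneg (z2 t / ρ t)]),
      (sq_le_one_iff_abs_le_one _).1 (by linarith [sq_nonneg (z1 t / ρ t)]), ?_⟩
    refine abs_le_of_sq_le_sq ?_ hr.le
    have : r ^ 2 = (h1 ^ 2 + h2 ^ 2) * ((z1 t / ρ t) ^ 2 + (z2 t / ρ t) ^ 2) := by
      rw [hu, hr2]; ring
    nlinarith [sq_nonneg (h1 * (z1 t / ρ t) + h2 * (z2 t / ρ t))]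
  have hI : ∀ {P : ℝ → Prop}, (∀ᶠ t in nhds tb, P t) → ∃ a' b', tb ∈ Ioo a' b' ∧
      Ioo a' b' ⊆ Ioo a b ∧ ∀ t ∈ Ioo a' b', P t := by
    intro P hP
    obtain ⟨a', b', hm, hs⟩ := mem_nhds_iff_exists_Ioo_subset.1
      (Filter.inter_mem (Ioo_mem_nhds htb.1 htb.2) hP)
    exact ⟨a', b', hm, fun t ht => (hs ht).1, fun t ht => (hs ht).2⟩
  have habs12 : |h12| < r := abs_lt_of_sq_lt_sq hgt hr.le
  obtain ⟨m, hm, hpbd⟩ : ∃ m > 0, ∀ᶠ t in nhds tb,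
      (tb ≤ t → m * (t - tb) ≤ p t) ∧ (t ≤ tb → m * (tb - t) ≤ - p t) := by
    have hlim : Filter.Tendsto (fun t => h1 * H1 t + h2 * H2 t - |H12 t| * r) (nhds tb)
        (nhds (h1 * h1 + h2 * h2 - |h12| * r)) :=
      ((hH1.const_mul h1).add (hH2.const_mul h2)).sub (hH12.abs.mul_const r)
    have hpos : 0 < h1 * h1 + h2 * h2 - |h12| * r := by nlinarith
    obtain ⟨a', b', hm', hs, hP⟩ := hI (hlim.eventually (lt_mem_nhds (half_lt_self hpos)))
    refine ⟨_, half_pos hpos, ?_⟩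
    have hmono := @LipschitzOnWith.mul_sub_le_sub_of_ae_hasDerivAt p _ a' b'
      ((h1 * h1 + h2 * h2 - |h12| * r) / 2) (hpL.mono hs) (by
        filter_upwards [hpd] with t ht hmem
        obtain ⟨htne, hder⟩ := ht (hs hmem)
        refine ⟨_, hder, ?_⟩
        have e1 := hP t hmem
        have e2 := (hcoef t (hs hmem) htne).2.2
        have e3 : -(|H12 t| * r) ≤ H12 t * (h2 * (z1 t / ρ t) - h1 * (z2 t / ρ t)) := by
          refine (abs_le.1 ?_).1
          rw [abs_mul]
          exact mul_le_mul_of_nonneg_left e2 (abs_nonneg _)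
        linarith)
    have hptb : p tb = 0 := by simp [p, hz1tb, hz2tb]
    filter_upwards [Ioo_mem_nhds hm'.1 hm'.2] with t ht
    refine ⟨fun h => ?_, fun h => ?_⟩
    · simpa [hptb] using hmono hm' ht h
    · simpa [hptb] using hmono ht hm' h
  have hgbd : ∀ ε > 0, ∀ᶠ t in nhds tb, |g t| ≤ ε * |t - tb| := by
    intro ε hε
    have hlim : Filter.Tendsto (fun t => |h1 * H2 t - h2 * H1 t| + |H12 t * h1 - h12 * H1 t|
        + |H12 t * h2 - h12 * H2 t|) (nhds tb)
        (nhds (|h1 * h2 - h2 * h1| + |h12 * h1 - h12 * h1| + |h12 * h2 - h12 * h2|)) :=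
      ((((hH2.const_mul h1).sub (hH1.const_mul h2)).abs).add
        (((hH12.mul_const h1).sub (hH1.const_mul h12)).abs)).add
        (((hH12.mul_const h2).sub (hH2.const_mul h12)).abs)
    have h0 : |h1 * h2 - h2 * h1| + |h12 * h1 - h12 * h1| + |h12 * h2 - h12 * h2| = 0 := by
      simp [mul_comm]
    rw [h0] at hlim
    obtain ⟨a', b', hm', hs, hP⟩ := hI (hlim.eventually (gt_mem_nhds hε))
    have hbd : ∀ᵐ t, t ∈ Ioo a' b' → ∃ d, HasDerivAt g d t ∧ |d| ≤ ε := by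
      filter_upwards [hgd] with t ht hmem
      obtain ⟨htne, hder⟩ := ht (hs hmem)
      refine ⟨_, hder, ?_⟩
      obtain ⟨e1, e2, -⟩ := hcoef t (hs hmem) htne
      refine le_trans ?_ (hP t hmem).le
      refine (abs_add_le _ _).trans (add_le_add ((abs_add_le _ _).trans
        (add_le_add le_rfl ?_)) ?_)
      · rw [abs_mul]; exact mul_le_of_le_one_right (abs_nonneg _) e1
      · rw [abs_mul]; exact mul_le_of_le_one_right (abs_nonneg _) e2
    have hlow := @LipschitzOnWith.mul_sub_le_sub_of_ae_hasDerivAt g _ a' b' (-ε) (hgL.mono hs) (by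
      filter_upwards [hbd] with t ht hmem
      obtain ⟨d, hd, hle⟩ := ht hmem
      exact ⟨d, hd, (abs_le.1 hle).1⟩)
    have hupp := @LipschitzOnWith.mul_sub_le_sub_of_ae_hasDerivAt (fun t => -g t) _ a' b' (-ε)
      (hgL.mono hs).neg (by
      filter_upwards [hbd] with t ht hmem
      obtain ⟨d, hd, hle⟩ := ht hmem
      exact ⟨-d, hd.neg, neg_le_neg (abs_le.1 hle).2⟩)
    have hgtb : g tb = 0 := by simp [g, hz1tb, hz2tb, hρtb]
    filter_upwards [Ioo_mem_nhds hm'.1 hm'.2] with t ht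
    rcases le_total tb t with h | h
    · have := hlow hm' ht h
      have := hupp hm' ht h
      rw [abs_of_nonneg (sub_nonneg.2 h), abs_le]
      constructor <;> linarith
    · have := hlow ht hm' h
      have := hupp ht hm' h
      rw [abs_of_nonpos (sub_nonpos.2 h), abs_le]
      constructor <;> linarith
  let A : ℝ → ℝ := fun t => p t / ρ t
  let B : ℝ → ℝ := fun t => (h1 * z2 t - h2 * z1 t) / ρ t
  have hnear : ∀ᶠ t in nhdsWithin tb {tb}ᶜ, t ∈ Ioo a b ∧ t ≠ tb :=
    Filter.inter_mem (mem_nhdsWithin_of_mem_nhds (Ioo_mem_nhds htb.1 htb.2)) self_mem_nhdsWithin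
  have hB : Filter.Tendsto B (nhdsWithin tb {tb}ᶜ) (nhds h12) := by
    rw [Metric.tendsto_nhds]
    intro ε hε
    have hε' : 0 < ε * m / (2 * r) := by positivity
    filter_upwards [hnear, mem_nhdsWithin_of_mem_nhds hpbd,
      mem_nhdsWithin_of_mem_nhds (hgbd _ hε')] with t ht hpt hgt
    have hp := hρpos t ht.1 ht.2
    have hBeq : B t - h12 = g t / ρ t := by simp only [B, g]; field_simp
    have hple : |p t| ≤ r * ρ t := by
      refine abs_le_of_sq_le_sq ?_ (mul_nonneg hr.le hp.le)
      rw [mul_pow, hρsq, hr2]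
      nlinarith [sq_nonneg (h1 * z2 t - h2 * z1 t)]
    have hmp : m * |t - tb| ≤ |p t| := by
      rcases le_total tb t with h | h
      · rw [abs_of_nonneg (sub_nonneg.2 h)]
        exact (hpt.1 h).trans (le_abs_self _)
      · rw [abs_of_nonpos (sub_nonpos.2 h), neg_sub]
        exact (hpt.2 h).trans (neg_le_abs _)
    rw [Real.dist_eq, hBeq, abs_div, abs_of_pos hp, div_lt_iff₀ hp]
    have h3 : |t - tb| ≤ r * ρ t / m := by rw [le_div_iff₀ hm]; linarith
    calc |g t| ≤ ε * m / (2 * r) * |t - tb| := hgt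
      _ ≤ ε * m / (2 * r) * (r * ρ t / m) := by gcongr
      _ = ε * ρ t / 2 := by field_simp
      _ < ε * ρ t := half_lt_self (by positivity)
  have hAB : ∀ t ∈ Ioo a b, t ≠ tb → A t ^ 2 = r ^ 2 - B t ^ 2 := by
    intro t ht htne
    have hp := (hρpos t ht htne).ne'
    have : A t ^ 2 + B t ^ 2 = r ^ 2 * ((z1 t / ρ t) ^ 2 + (z2 t / ρ t) ^ 2) := by
      rw [hr2]; simp only [A, B, p]; field_simp; ring
    rw [hunit t ht htne] at this
    linarith
  have hsqrt : Filter.Tendsto (fun t => √(r ^ 2 - B t ^ 2)) (nhdsWithin tb {tb}ᶜ)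
      (nhds √(r ^ 2 - h12 ^ 2)) := ((hB.pow 2).const_sub _).sqrt
  have hz : ∀ t ∈ Ioo a b, t ≠ tb → (1 / r ^ 2) * (-h2 * B t + h1 * A t) = z1 t / ρ t ∧
      (1 / r ^ 2) * (h1 * B t + h2 * A t) = z2 t / ρ t := by
    intro t ht htne
    have hp := (hρpos t ht htne).ne'
    simp only [A, B, p]
    constructor
    · field_simp
      rw [hr2]; ring
    · field_simp
      rw [hr2]; ring
  have hconcl : ∀ (l : Filter ℝ) (s : ℝ), l ≤ nhdsWithin tb {tb}ᶜ →
      Filter.Tendsto A l (nhds s) →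
      Filter.Tendsto (fun t => (z1 t / ρ t, z2 t / ρ t)) l
        (nhds ((1 / r ^ 2) * (-h2 * h12 + h1 * s), (1 / r ^ 2) * (h1 * h12 + h2 * s))) := by
    intro l s hl hA
    have hBl := hB.mono_left hl
    refine Filter.Tendsto.congr' ?_
      (((((hBl.const_mul (-h2)).add (hA.const_mul h1)).const_mul (1 / r ^ 2))).prodMk_nhds
        ((((hBl.const_mul h1).add (hA.const_mul h2)).const_mul (1 / r ^ 2))))
    filter_upwards [hl hnear] with t ht
    obtain ⟨e1, e2⟩ := hz t ht.1 ht.2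
    rw [e1, e2]
  have hleft : nhdsWithin tb (Iio tb) ≤ nhdsWithin tb {tb}ᶜ :=
    nhdsWithin_mono _ fun t ht => ne_of_lt ht
  have hright : nhdsWithin tb (Ioi tb) ≤ nhdsWithin tb {tb}ᶜ :=
    nhdsWithin_mono _ fun t ht => ne_of_gt ht
  constructor
  · have := hconcl _ (-√(r ^ 2 - h12 ^ 2)) hleft (by
      refine Filter.Tendsto.congr' ?_ (hsqrt.mono_left hleft).neg
      filter_upwards [hleft hnear, mem_nhdsWithin_of_mem_nhds hpbd, self_mem_nhdsWithin]
        with t ht hpt hlt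
      have hApos : A t ≤ 0 := by
        refine div_nonpos_of_nonpos_of_nonneg ?_ (hρpos t ht.1 ht.2).le
        have := hpt.2 (le_of_lt hlt)
        have : 0 ≤ m * (tb - t) := mul_nonneg hm.le (sub_nonneg.2 (le_of_lt hlt))
        linarith
      rw [← hAB t ht.1 ht.2, Real.sqrt_sq_eq_abs, abs_of_nonpos hApos, neg_neg])
    simpa only [mul_neg, ← sub_eq_add_neg] using this
  · refine hconcl _ (√(r ^ 2 - h12 ^ 2)) hright ?_
    refine Filter.Tendsto.congr' ?_ (hsqrt.mono_left hright)
    filter_upwards [hright hnear, mem_nhdsWithin_of_mem_nhds hpbd, self_mem_nhdsWithin]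
      with t ht hpt hlt
    have hApos : 0 ≤ A t := by
      refine div_nonneg ?_ (hρpos t ht.1 ht.2).le
      have := hpt.1 (le_of_lt hlt)
      have : 0 ≤ m * (t - tb) := mul_nonneg hm.le (sub_nonneg.2 (le_of_lt hlt))
      linarith
    rw [← hAB t ht.1 ht.2, Real.sqrt_sq_eq_abs, abs_of_nonneg hApos]

theorem dot3_add (a b c : E3) : dot3 a (b + c) = dot3 a b + dot3 a c := by
  simp [dot3, mul_add, Finset.sum_add_distrib]

theorem dot3_sub (a b c : E3) : dot3 a (b - c) = dot3 a b - dot3 a c := by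
  simp [dot3, mul_sub, Finset.sum_sub_distrib]

theorem dot3_smul (s : ℝ) (a b : E3) : dot3 a (s • b) = s * dot3 a b := by
  simp only [dot3, Pi.smul_apply, smul_eq_mul, Finset.mul_sum]
  exact Finset.sum_congr rfl fun i _ => by ring

theorem hF_lie (f g : E3 → E3) (l : E3 × E3) :
    hF (lie f g) l = dot3 l.1 (fderiv ℝ g l.2 (f l.2)) - dot3 l.1 (fderiv ℝ f l.2 (g l.2)) := by
  rw [hF, lie, dot3_sub]

theorem hF_lie_self (f : E3 → E3) (l : E3 × E3) : hF (lie f f) l = 0 := by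
  rw [hF_lie, sub_self]

theorem hF_lie_swap (f g : E3 → E3) (l : E3 × E3) : hF (lie f g) l = -hF (lie g f) l := by
  rw [hF_lie, hF_lie, neg_sub]

theorem ContDiff.hF {n : WithTop ℕ∞} {f : E3 → E3} (hf : ContDiff ℝ n f) :
    ContDiff ℝ n (hF f) := by
  unfold _root_.hF dot3
  fun_prop

theorem ContDiff.continuous_hF_lie {f g : E3 → E3} (hf : ContDiff ℝ (⊤ : ℕ∞) f)
    (hg : ContDiff ℝ (⊤ : ℕ∞) g) : Continuous (_root_.hF (lie f g)) := by
  have hf' := hf.continuous_fderiv (by simp)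
  have hg' := hg.continuous_fderiv (by simp)
  have hl : Continuous (lie f g) :=
    (hg'.clm_apply hf.continuous).sub (hf'.clm_apply hg.continuous)
  unfold _root_.hF dot3
  fun_prop

/-- The derivative of a Hamiltonian lift along a solution of the Hamiltonian system. -/
theorem hasDerivAt_hF_comp {f0 f1 f2 f : E3 → E3} {v : ℝ × ℝ} {lam : ℝ → E3 × E3} {t : ℝ}
    (hf : DifferentiableAt ℝ f (lam t).2)
    (hx : HasDerivAt (fun s => (lam s).2)
      (f0 ((lam t).2) + v.1 • f1 ((lam t).2) + v.2 • f2 ((lam t).2)) t)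
    {w : E3} (hw : HasDerivAt (fun s => (lam s).1) w t)
    (hwv : ∀ y : E3, dot3 w y = - dot3 ((lam t).1)
          (fderiv ℝ f0 ((lam t).2) y + v.1 • fderiv ℝ f1 ((lam t).2) y
            + v.2 • fderiv ℝ f2 ((lam t).2) y)) :
    HasDerivAt (fun s => hF f (lam s))
      (hF (lie f0 f) (lam t) + v.1 * hF (lie f1 f) (lam t) + v.2 * hF (lie f2 f) (lam t)) t := by
  have hfx := hf.hasFDerivAt.comp_hasDerivAt t hx
  have hsum := HasDerivAt.fun_sum (u := Finset.univ) fun i _ =>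
    ((hasDerivAt_pi.1 hw i).mul (hasDerivAt_pi.1 hfx i))
  refine hsum.congr_deriv ?_
  rw [Finset.sum_add_distrib]
  change dot3 w (f (lam t).2) + dot3 (lam t).1 _ = _
  simp only [hwv, hF_lie, map_add, map_smul, dot3_add, dot3_smul]
  ring

/-- A maximizer over the unit disk of a nonzero linear form is its normalized gradient. -/
theorem eq_div_sqrt_of_forall_le {a b : ℝ} (h : 0 < a ^ 2 + b ^ 2) {w : ℝ × ℝ} (hw : w ∈ U2)
    (hmax : ∀ v ∈ U2, v.1 * a + v.2 * b ≤ w.1 * a + w.2 * b) :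
    w = (a / √(a ^ 2 + b ^ 2), b / √(a ^ 2 + b ^ 2)) := by
  have hs : 0 < √(a ^ 2 + b ^ 2) := Real.sqrt_pos.2 h
  have hsq : √(a ^ 2 + b ^ 2) ^ 2 = a ^ 2 + b ^ 2 := Real.sq_sqrt h.le
  set s := √(a ^ 2 + b ^ 2)
  have hunit : (a / s) ^ 2 + (b / s) ^ 2 = 1 := by
    rw [div_pow, div_pow, ← add_div, ← hsq]
    field_simp
  have hm := hmax (a / s, b / s) hunit.le
  have e : a / s * a + b / s * b = s := by
    field_simp
    linarith
  simp only [e] at hm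
  have hw' : w.1 ^ 2 + w.2 ^ 2 ≤ 1 := hw
  have ha : a = a / s * s := by field_simp
  have hb : b = b / s * s := by field_simp
  have hdot : 1 ≤ w.1 * (a / s) + w.2 * (b / s) := by
    have : w.1 * a + w.2 * b = (w.1 * (a / s) + w.2 * (b / s)) * s := by field_simp
    rw [this] at hm
    exact le_of_mul_le_mul_right (by linarith) hs
  have h1 : w.1 - a / s = 0 := by
    refine pow_eq_zero_iff two_ne_zero |>.1 (le_antisymm ?_ (sq_nonneg _))
    nlinarith [sq_nonneg (w.2 - b / s)]
  have h2 : w.2 - b / s = 0 := by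
    refine pow_eq_zero_iff two_ne_zero |>.1 (le_antisymm ?_ (sq_nonneg _))
    nlinarith [sq_nonneg (w.1 - a / s)]
  exact Prod.ext (by linarith) (by linarith)

/-- **jump formula (3.5).** Under `h₀₁² + h₀₂² + h₁₂² ≠ 0` and
`r² > h₁₂²`, the control of the extremal passing through `λ̄` (at time `t̄`, off the
singular locus for `t ≠ t̄`) has a jump at `t̄` with the one-sided limits
`u(t̄ ± 0) = (1/r²)(−h₀₂h₁₂ ± h₀₁√(r²−h₁₂²), h₀₁h₁₂ ± h₀₂√(r²−h₁₂²))`. -/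
theorem statement4 (f0 f1 f2 : E3 → E3)
    (hf0 : ContDiff ℝ (⊤ : ℕ∞) f0) (hf1 : ContDiff ℝ (⊤ : ℕ∞) f1) (hf2 : ContDiff ℝ (⊤ : ℕ∞) f2)
    (hli : ∀ q : E3, LinearIndependent ℝ ![f1 q, f2 q])
    (qb : E3) (lb : E3 × E3) (h01 h02 h12 r : ℝ)
    (hlb : lb = (crossProduct (f1 qb) (f2 qb), qb))
    (hh01 : h01 = hF (lie f0 f1) lb) (hh02 : h02 = hF (lie f0 f2) lb)
    (hh12 : h12 = hF (lie f1 f2) lb) (hr : r = Real.sqrt (h01 ^ 2 + h02 ^ 2))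
    (hnondeg : h01 ^ 2 + h02 ^ 2 + h12 ^ 2 ≠ 0)
    (hgt : r ^ 2 > h12 ^ 2)
    (a b tb : ℝ) (hab : a < b) (htb : tb ∈ Ioo a b)
    (u : ℝ → ℝ × ℝ) (lam : ℝ → E3 × E3)
    (hext : IsExtremal f0 f1 f2 u lam (Ioo a b))
    (hpass : lam tb = lb)
    (hoff : ∀ t ∈ Ioo a b, t ≠ tb → lam t ∉ SingLocus f1 f2) :
    ∃ v : ℝ → ℝ × ℝ,
      (∀ᵐ t, t ∈ Ioo a b → u t = v t) ∧
      Filter.Tendsto v (nhdsWithin tb (Iio tb))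
        (nhds ((1 / r ^ 2) * (-h02 * h12 - h01 * Real.sqrt (r ^ 2 - h12 ^ 2)),
               (1 / r ^ 2) * (h01 * h12 - h02 * Real.sqrt (r ^ 2 - h12 ^ 2)))) ∧
      Filter.Tendsto v (nhdsWithin tb (Ioi tb))
        (nhds ((1 / r ^ 2) * (-h02 * h12 + h01 * Real.sqrt (r ^ 2 - h12 ^ 2)),
               (1 / r ^ 2) * (h01 * h12 + h02 * Real.sqrt (r ^ 2 - h12 ^ 2)))) := by
  obtain ⟨⟨K, hK⟩, ⟨-, hu⟩, -, hae⟩ := hext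
  have hr0 : 0 < r ^ 2 := lt_of_le_of_lt (sq_nonneg _) hgt
  have hrpos : 0 < r := lt_of_le_of_ne (hr ▸ Real.sqrt_nonneg _) fun h => by simp [← h] at hr0
  have hr2 : r ^ 2 = h01 ^ 2 + h02 ^ 2 := by rw [hr]; exact Real.sq_sqrt (by positivity)
  have hlam : ContinuousAt lam tb := hK.continuousOn.continuousAt (Ioo_mem_nhds htb.1 htb.2)
  have hne : ∀ t ∈ Ioo a b, t ≠ tb → 0 < hF f1 (lam t) ^ 2 + hF f2 (lam t) ^ 2 := by
    intro t ht htne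
    by_contra hcon
    have h1 := sq_nonneg (hF f1 (lam t))
    have h2 := sq_nonneg (hF f2 (lam t))
    exact hoff t ht htne ⟨pow_eq_zero_iff two_ne_zero |>.1 (by linarith),
      pow_eq_zero_iff two_ne_zero |>.1 (by linarith)⟩
  have hneq : ∀ᵐ t : ℝ, t ≠ tb := by simp [ae_iff, measure_singleton]
  let v : ℝ → ℝ × ℝ := fun t =>
    (hF f1 (lam t) / √(hF f1 (lam t) ^ 2 + hF f2 (lam t) ^ 2),
      hF f2 (lam t) / √(hF f1 (lam t) ^ 2 + hF f2 (lam t) ^ 2))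
  have huv : ∀ᵐ t, t ∈ Ioo a b → u t = v t := by
    filter_upwards [hae, hneq] with t ht htne hmem
    obtain ⟨-, -, hmax, -⟩ := ht hmem
    refine eq_div_sqrt_of_forall_le (hne t hmem htne) (hu t hmem) fun w hw => ?_
    have := hmax w hw
    simp only [Ham] at this
    linarith
  have hd : ∀ᵐ t, t ∈ Ioo a b →
      HasDerivAt (fun s => hF f1 (lam s))
        (hF (lie f0 f1) (lam t) - (v t).2 * hF (lie f1 f2) (lam t)) t ∧
      HasDerivAt (fun s => hF f2 (lam s))
        (hF (lie f0 f2) (lam t) + (v t).1 * hF (lie f1 f2) (lam t)) t := by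
    filter_upwards [hae, huv] with t ht hut hmem
    obtain ⟨hx, ⟨w, hw, hwv⟩, -, -⟩ := ht hmem
    rw [← hut hmem]
    refine ⟨(hasDerivAt_hF_comp (hf1.differentiable (by simp) _) hx hw hwv).congr_deriv ?_,
      (hasDerivAt_hF_comp (hf2.differentiable (by simp) _) hx hw hwv).congr_deriv ?_⟩
    · rw [hF_lie_self, hF_lie_swap f2 f1]; ring
    · rw [hF_lie_self]; ring
  have hLip : ∀ {f : E3 → E3}, ContDiff ℝ (⊤ : ℕ∞) f →
      ∃ C, ∀ᶠ s in (nhds tb).smallSets, LipschitzOnWith C (fun t => hF f (lam t)) s := by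
    intro f hf
    obtain ⟨C, s, hs, hC⟩ := ((hf.hF.of_le (by exact_mod_cast le_top)).contDiffAt
      (x := lam tb)).exists_lipschitzOnWith
    refine ⟨C * K, Filter.eventually_smallSets.2 ⟨lam ⁻¹' s ∩ Ioo a b,
      Filter.inter_mem (hlam hs) (Ioo_mem_nhds htb.1 htb.2), fun s' hs' => ?_⟩⟩
    exact hC.comp (hK.mono fun t ht => (hs' ht).2) fun t ht => (hs' ht).1
  obtain ⟨C1, hC1⟩ := hLip hf1
  obtain ⟨C2, hC2⟩ := hLip hf2
  obtain ⟨s, hs, hsL⟩ := Filter.eventually_smallSets.1 (hC1.and hC2)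
  obtain ⟨a', b', hmem, hsub⟩ := mem_nhds_iff_exists_Ioo_subset.1
    (Filter.inter_mem (Ioo_mem_nhds htb.1 htb.2) hs)
  have hab' : Ioo a' b' ⊆ Ioo a b := fun t ht => (hsub ht).1
  obtain ⟨hL1, hL2⟩ := hsL (Ioo a' b') fun t ht => (hsub ht).2
  have hlim : ∀ {f g : E3 → E3}, ContDiff ℝ (⊤ : ℕ∞) f → ContDiff ℝ (⊤ : ℕ∞) g →
      Filter.Tendsto (fun t => hF (lie f g) (lam t)) (nhds tb) (nhds (hF (lie f g) lb)) := by
    intro f g hf hg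
    have := (hf.continuous_hF_lie hg).continuousAt.tendsto.comp hlam.tendsto
    rwa [hpass] at this
  have hzero1 : hF f1 (lam tb) = 0 := by
    rw [hpass, hlb]
    simp [hF, dot3, cross_apply, Fin.sum_univ_three]
    ring
  have hzero2 : hF f2 (lam tb) = 0 := by
    rw [hpass, hlb]
    simp [hF, dot3, cross_apply, Fin.sum_univ_three]
    ring
  exact ⟨v, huv, tendsto_direction_of_planar_system hmem
    (hL1.weaken (le_max_left C1 C2)) (hL2.weaken (le_max_right C1 C2)) hzero1 hzero2
    (fun t ht => hne t (hab' ht)) (hh01 ▸ hlim hf0 hf1) (hh02 ▸ hlim hf0 hf2)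
    (hh12 ▸ hlim hf1 hf2) hrpos hr2 hgt (hd.mono fun t ht htm => ht (hab' htm))⟩
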